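/- Let W ⊆ End(V) be invariant and irreducible under the conjugation action X ↦ R(g) X R(g)*, with every element of W mapping each V_k into itself and a := dim(W^H)/dim(W) > 0. Suppose W admits a Hilbert–Schmidt-orthogonal basis {O_β}_{β∈B} of self-adjoint operators all having the same operator norm, such that (i) for every g ∈ G and β ∈ B there exist γ ∈ B and c ∈ ℂ with R(g) O_β R(g)* = c · O_γ, and (ii) each O_β is either diagonal in the measurement basis (⟨w_i, O_β w_j⟩ = 0 for all i ≠ j) or has vanishing diagonal (⟨w_i, O_β w_i⟩ = 0 for all i). Then for each α ∈ B, the estimator with Y = a⁻¹ O_α satisfies Var[ô] ≤ ‖O_α‖_∞² / a for every density matrix ρ. -/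

import Mathlib

open Matrix
open scoped BigOperators ComplexOrder

noncomputable section

/-- Conjugation `X ↦ U X U*` as a linear endomorphism of `End(ℂ^d)`. -/
def conjMap {d : ℕ} (U : Matrix (Fin d) (Fin d) ℂ) :
    Matrix (Fin d) (Fin d) ℂ →ₗ[ℂ] Matrix (Fin d) (Fin d) ℂ :=
  (LinearMap.mulLeft ℂ U).comp (LinearMap.mulRight ℂ (star U))

/-- The probability `p(g,i) = (1/|G|) ⟨w_i, R(g) ρ R(g)* w_i⟩` of the single-shot
outcome `(g, i)`. -/
def prob {G : Type*} [Group G] [Fintype G] {d : ℕ}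
    (R : G →* Matrix.unitaryGroup (Fin d) ℂ) (w : Fin d → Fin d → ℂ)
    (ρ : Matrix (Fin d) (Fin d) ℂ) (g : G) (i : Fin d) : ℝ :=
  (((Fintype.card G : ℂ))⁻¹ *
    ∑ x, star (w i x) *
      (((R g : Matrix (Fin d) (Fin d) ℂ) * ρ *
          star (R g : Matrix (Fin d) (Fin d) ℂ)).mulVec (w i)) x).re

/-- The single-shot estimator value `ô(g,i) = ⟨w_i, R(g) Y R(g)* w_i⟩`. -/
def est {G : Type*} [Group G] [Fintype G] {d : ℕ}
    (R : G →* Matrix.unitaryGroup (Fin d) ℂ) (w : Fin d → Fin d → ℂ)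
    (Y : Matrix (Fin d) (Fin d) ℂ) (g : G) (i : Fin d) : ℝ :=
  (∑ x, star (w i x) *
      (((R g : Matrix (Fin d) (Fin d) ℂ) * Y *
          star (R g : Matrix (Fin d) (Fin d) ℂ)).mulVec (w i)) x).re

/-- The mean `E[ô] = Σ_{g,i} p(g,i) ô(g,i)` of the single-shot estimator. -/
def mean {G : Type*} [Group G] [Fintype G] {d : ℕ}
    (R : G →* Matrix.unitaryGroup (Fin d) ℂ) (w : Fin d → Fin d → ℂ)
    (ρ Y : Matrix (Fin d) (Fin d) ℂ) : ℝ :=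
  ∑ g : G, ∑ i : Fin d, prob R w ρ g i * est R w Y g i

/-- The variance `Var[ô] = Σ_{g,i} p(g,i) ô(g,i)² − (E[ô])²` of the single-shot
estimator. -/
def variance {G : Type*} [Group G] [Fintype G] {d : ℕ}
    (R : G →* Matrix.unitaryGroup (Fin d) ℂ) (w : Fin d → Fin d → ℂ)
    (ρ Y : Matrix (Fin d) (Fin d) ℂ) : ℝ :=
  (∑ g : G, ∑ i : Fin d, prob R w ρ g i * (est R w Y g i) ^ 2) - (mean R w ρ Y) ^ 2

/-- The operator (spectral) norm `‖·‖_∞` of a matrix, i.e. the norm of the induced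
continuous linear map on the euclidean space `ℂ^d`. -/
def opNorm {d : ℕ} (A : Matrix (Fin d) (Fin d) ℂ) : ℝ :=
  ‖Matrix.toEuclideanCLM (𝕜 := ℂ) A‖

/-- The conjugation representation `g ↦ (X ↦ R(g) X R(g)*)` on matrices. -/
def conjRep {G : Type*} [Group G] {d : ℕ} (R : G →* Matrix.unitaryGroup (Fin d) ℂ) :
    Representation ℂ G (Matrix (Fin d) (Fin d) ℂ) where
  toFun g := conjMap (R g : Matrix (Fin d) (Fin d) ℂ)
  map_one' := by
    ext1 X
    simp [conjMap]
  map_mul' g h := by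
    ext1 X
    simp [conjMap, mul_assoc]

lemma conjMap_apply {d : ℕ} (U X : Matrix (Fin d) (Fin d) ℂ) :
    conjMap U X = U * X * star U := by
  simp [conjMap, mul_assoc]

/-- A representation mapping each member of a linearly independent family to a multiple of
another member induces an action on the index set. -/
lemma exists_mulAction_of_monomial {K G V B : Type*} [Field K] [Group G] [AddCommGroup V]
    [Module K V] (τ : Representation K G V) {v : B → V} (hv : LinearIndependent K v)
    (hperm : ∀ g b, ∃ (b' : B) (c : K), τ g (v b) = c • v b') :
    ∃ _ : MulAction G B, ∀ (g : G) (b : B), ∃ c : K, c ≠ 0 ∧ τ g (v b) = c • v (g • b) := by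
  choose σ c hσ using hperm
  have hc : ∀ g b, c g b ≠ 0 := fun g b h0 => by
    have h1 : τ g⁻¹ (τ g (v b)) = v b := by
      rw [← Module.End.mul_apply, ← map_mul]
      simp
    rw [hσ, h0, zero_smul, map_zero] at h1
    exact hv.ne_zero b h1.symm
  have huniq : ∀ {b b' : B} {r s : K}, r ≠ 0 → r • v b = s • v b' → b = b' := by
    intro b b' r s hr h
    by_contra hne
    refine hv.notMem_span_image (s := {b'}) hne ?_
    rw [Set.image_singleton, Submodule.mem_span_singleton]
    exact ⟨r⁻¹ * s, by rw [mul_smul, ← h, inv_smul_smul₀ hr]⟩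
  refine ⟨{ smul := σ, one_smul := fun b => ?_, mul_smul := fun g h b => ?_ }, fun g b =>
    ⟨c g b, hc g b, hσ g b⟩⟩
  · refine huniq (hc (g * h) b) (s := c h b * c g (σ h b)) ?_
    refine (hσ (g * h) b).symm.trans ?_
    rw [map_mul, Module.End.mul_apply, hσ h b, map_smul, hσ g, smul_smul]
    rfl
  · refine huniq (s := 1) (hc 1 b) ((hσ 1 b).symm.trans ?_)
    rw [map_one, Module.End.one_apply, one_smul]

/-- If the span of a monomial family is irreducible, the induced action is transitive. -/
lemma isPretransitive_of_irreducible_span {K G V B : Type*} [Field K] [Group G] [AddCommGroup V]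
    [Module K V] [MulAction G B] (τ : Representation K G V) {v : B → V}
    (hv : LinearIndependent K v)
    (hact : ∀ (g : G) (b : B), ∃ c : K, c ≠ 0 ∧ τ g (v b) = c • v (g • b))
    (hirr : ∀ W' : Submodule K V, W' ≤ Submodule.span K (Set.range v) →
      (∀ g, ∀ x ∈ W', τ g x ∈ W') → W' = ⊥ ∨ W' = Submodule.span K (Set.range v)) :
    MulAction.IsPretransitive G B := by
  refine ⟨fun x y => ?_⟩
  have hx : v x ∈ Submodule.span K (v '' MulAction.orbit G x) :=
    Submodule.subset_span ⟨x, MulAction.mem_orbit_self x, rfl⟩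
  have hinv : ∀ g, ∀ z ∈ Submodule.span K (v '' MulAction.orbit G x),
      τ g z ∈ Submodule.span K (v '' MulAction.orbit G x) := by
    intro g z hz
    induction hz using Submodule.span_induction with
    | mem z hz =>
      obtain ⟨b, hb, rfl⟩ := hz
      obtain ⟨c, -, hc⟩ := hact g b
      rw [hc]
      refine Submodule.smul_mem _ _ (Submodule.subset_span ⟨g • b, ?_, rfl⟩)
      exact MulAction.mem_orbit_of_mem_orbit g hb
    | zero => simp
    | add p q _ _ hp hq => simpa using Submodule.add_mem _ hp hq
    | smul r p _ hp => simpa using Submodule.smul_mem _ r hp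
  rcases hirr _ (Submodule.span_mono (Set.image_subset_range _ _)) hinv with h | h
  · rw [h, Submodule.mem_bot] at hx
    exact absurd hx (hv.ne_zero x)
  · have hy : v y ∈ Submodule.span K (v '' MulAction.orbit G x) := by
      rw [h]
      exact Submodule.subset_span ⟨y, rfl⟩
    by_contra hne
    exact hv.notMem_span_image (s := MulAction.orbit G x) (x := y) hne hy

/-- Under a transitive action, the orbit map of a point equidistributes over the finite set. -/
lemma card_filter_smul_mem_mul_card {G B : Type*} [Group G] [Fintype G] [Fintype B]
    [DecidableEq B] [MulAction G B] [MulAction.IsPretransitive G B] (D : Finset B) (x : B) :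
    (Finset.univ.filter fun g : G => g • x ∈ D).card * Fintype.card B
      = Fintype.card G * D.card := by
  have hconst : ∀ y : B, (Finset.univ.filter fun g : G => g • y ∈ D).card
      = (Finset.univ.filter fun g : G => g • x ∈ D).card := fun y => by
    obtain ⟨h, rfl⟩ := MulAction.exists_smul_eq G x y
    refine Finset.card_equiv (Equiv.mulRight h) fun g => ?_
    simp [mul_smul]
  calc (Finset.univ.filter fun g : G => g • x ∈ D).card * Fintype.card B
      = ∑ y : B, (Finset.univ.filter fun g : G => g • y ∈ D).card := by
        simp [hconst, mul_comm]
    _ = ∑ g : G, (Finset.univ.filter fun y : B => g • y ∈ D).card := by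
        simp only [Finset.card_filter]
        exact Finset.sum_comm
    _ = ∑ _g : G, D.card := by
        refine Finset.sum_congr rfl fun g _ => ?_
        refine Finset.card_equiv (MulAction.toPerm g) fun y => ?_
        simp
    _ = Fintype.card G * D.card := by simp

section Orthonormal

variable {d : ℕ} {w : Fin d → Fin d → ℂ}

/-- The matrix with columns an orthonormal family is unitary. -/
lemma conjTranspose_transpose_of_mul_self
    (horth : ∀ i j, (∑ x, star (w i x) * w j x) = if i = j then 1 else 0) :
    ((Matrix.of w)ᵀ)ᴴ * (Matrix.of w)ᵀ = 1 := by
  ext i j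
  simpa [Matrix.mul_apply, Matrix.one_apply] using horth i j

lemma conjTranspose_mul_mul_apply (A : Matrix (Fin d) (Fin d) ℂ) (i j : Fin d) :
    (((Matrix.of w)ᵀ)ᴴ * A * (Matrix.of w)ᵀ) i j = ∑ x, star (w i x) * (A *ᵥ w j) x := by
  rw [mul_assoc]
  simp [Matrix.mul_apply, Matrix.mulVec, dotProduct]

lemma sum_sum_star_mul_mulVec_eq_trace
    (horth : ∀ i j, (∑ x, star (w i x) * w j x) = if i = j then 1 else 0)
    (A : Matrix (Fin d) (Fin d) ℂ) :
    ∑ i, ∑ x, star (w i x) * (A *ᵥ w i) x = A.trace := by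
  have h := mul_eq_one_comm.1 (conjTranspose_transpose_of_mul_self horth)
  simp_rw [← conjTranspose_mul_mul_apply]
  change Matrix.trace _ = _
  rw [Matrix.trace_mul_cycle, h, one_mul]

/-- A matrix diagonal in an orthonormal eigenbasis of a unitary is fixed by conjugation by that
unitary. -/
lemma conjMap_eq_self_of_diagonal
    (horth : ∀ i j, (∑ x, star (w i x) * w j x) = if i = j then 1 else 0)
    {U X : Matrix (Fin d) (Fin d) ℂ} (hU : U * star U = 1) {c : Fin d → ℂ}
    (heig : ∀ i, U *ᵥ w i = c i • w i)
    (hX : ∀ i j, i ≠ j → (∑ x, star (w i x) * (X *ᵥ w j) x) = 0) :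
    conjMap U X = X := by
  set M := (Matrix.of w)ᵀ with hM
  have h1 : Mᴴ * M = 1 := conjTranspose_transpose_of_mul_self horth
  have h2 : M * Mᴴ = 1 := mul_eq_one_comm.1 h1
  have hdX : Mᴴ * X * M = Matrix.diagonal fun i => (Mᴴ * X * M) i i := by
    ext i j
    by_cases hij : i = j
    · simp [hij]
    · rw [Matrix.diagonal_apply_ne _ hij, hM, conjTranspose_mul_mul_apply, hX i j hij]
  have hdU : Mᴴ * U * M = Matrix.diagonal c := by
    ext i j
    rw [hM, conjTranspose_mul_mul_apply, heig j]
    have : ∑ x, star (w i x) * (c j • w j) x = c j * ∑ x, star (w i x) * w j x := by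
      rw [Finset.mul_sum]
      exact Finset.sum_congr rfl fun x _ => by simp; ring
    rw [this, horth]
    by_cases hij : i = j <;> simp [hij]
  have hback : ∀ A : Matrix (Fin d) (Fin d) ℂ, M * (Mᴴ * A * M) * Mᴴ = A := fun A => by
    calc M * (Mᴴ * A * M) * Mᴴ = (M * Mᴴ) * A * (M * Mᴴ) := by simp only [mul_assoc]
      _ = A := by rw [h2, one_mul, mul_one]
  have hconj : ∀ A B : Matrix (Fin d) (Fin d) ℂ,
      (Mᴴ * A * M) * (Mᴴ * B * M) = Mᴴ * (A * B) * M := fun A B => by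
    calc (Mᴴ * A * M) * (Mᴴ * B * M) = Mᴴ * A * (M * Mᴴ) * B * M := by simp only [mul_assoc]
      _ = Mᴴ * (A * B) * M := by rw [h2, mul_one]; simp only [mul_assoc]
  have hcomm : U * X = X * U := by
    rw [← hback (U * X), ← hback (X * U), ← hconj, ← hconj, hdX, hdU,
      Matrix.diagonal_mul_diagonal, Matrix.diagonal_mul_diagonal]
    simp only [mul_comm]
  rw [conjMap_apply, hcomm, mul_assoc, hU, mul_one]

end Orthonormal

lemma abs_re_dotProduct_mulVec_le_opNorm {d : ℕ} (A : Matrix (Fin d) (Fin d) ℂ)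
    {v : Fin d → ℂ} (hv : star v ⬝ᵥ v = 1) : |(star v ⬝ᵥ A *ᵥ v).re| ≤ opNorm A := by
  set u : EuclideanSpace ℂ (Fin d) := WithLp.toLp 2 v
  have hu : ‖u‖ = 1 := by
    have h : inner ℂ u u = (1 : ℂ) := by
      rw [EuclideanSpace.inner_eq_star_dotProduct, dotProduct_comm]
      exact hv
    rw [inner_self_eq_norm_sq_to_K] at h
    have h' : ‖u‖ ^ 2 = 1 := by
      rw [← Complex.ofReal_inj, Complex.ofReal_pow]
      exact h
    nlinarith [norm_nonneg u]
  have hin : star v ⬝ᵥ A *ᵥ v = inner ℂ u (Matrix.toEuclideanCLM (𝕜 := ℂ) A u) := by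
    rw [EuclideanSpace.inner_eq_star_dotProduct, dotProduct_comm]
    rfl
  rw [hin]
  calc |(inner ℂ u (Matrix.toEuclideanCLM (𝕜 := ℂ) A u)).re|
      ≤ ‖inner ℂ u (Matrix.toEuclideanCLM (𝕜 := ℂ) A u)‖ := Complex.abs_re_le_norm _
    _ ≤ ‖u‖ * ‖Matrix.toEuclideanCLM (𝕜 := ℂ) A u‖ := norm_inner_le_norm _ _
    _ ≤ ‖u‖ * (opNorm A * ‖u‖) := by gcongr; exact ContinuousLinearMap.le_opNorm _ _
    _ = opNorm A := by rw [hu]; ring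

section Estimator

variable {G : Type*} [Group G] [Fintype G] {d : ℕ} (R : G →* Matrix.unitaryGroup (Fin d) ℂ)
  (w : Fin d → Fin d → ℂ)

/-- The operator norm of the observable bounds each single-shot estimate. -/
lemma abs_est_le_opNorm
    (horth : ∀ i j, (∑ x, star (w i x) * w j x) = if i = j then 1 else 0)
    (Y : Matrix (Fin d) (Fin d) ℂ) (g : G) (i : Fin d) : |est R w Y g i| ≤ opNorm Y := by
  set U : Matrix (Fin d) (Fin d) ℂ := (R g : Matrix (Fin d) (Fin d) ℂ)
  have hU : U * star U = 1 := Matrix.mem_unitaryGroup_iff.1 (R g).2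
  have hadj : ∀ z : Fin d → ℂ, star (w i) ⬝ᵥ U *ᵥ z = star (star U *ᵥ w i) ⬝ᵥ z := fun z => by
    rw [Matrix.star_mulVec, Matrix.star_eq_conjTranspose, Matrix.conjTranspose_conjTranspose,
      Matrix.dotProduct_mulVec]
  have hv : star (star U *ᵥ w i) ⬝ᵥ (star U *ᵥ w i) = 1 := by
    rw [← hadj, Matrix.mulVec_mulVec, hU, Matrix.one_mulVec]
    simpa [dotProduct] using horth i i
  have hest : est R w Y g i = (star (star U *ᵥ w i) ⬝ᵥ Y *ᵥ (star U *ᵥ w i)).re := by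
    rw [← hadj, Matrix.mulVec_mulVec, Matrix.mulVec_mulVec]
    rfl
  rw [hest]
  exact abs_re_dotProduct_mulVec_le_opNorm Y hv

lemma est_ofReal_smul (r : ℝ) (Y : Matrix (Fin d) (Fin d) ℂ) (g : G) (i : Fin d) :
    est R w ((r : ℂ) • Y) g i = r * est R w Y g i := by
  unfold est
  rw [← Complex.re_ofReal_mul, Finset.mul_sum]
  congr 1
  refine Finset.sum_congr rfl fun x _ => ?_
  simp only [Matrix.mul_smul, Matrix.smul_mul, Matrix.smul_mulVec, Pi.smul_apply, smul_eq_mul]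
  ring

lemma prob_nonneg {ρ : Matrix (Fin d) (Fin d) ℂ} (hρ : ρ.PosSemidef) (g : G) (i : Fin d) :
    0 ≤ prob R w ρ g i := by
  have h := (hρ.mul_mul_conjTranspose_same (R g : Matrix (Fin d) (Fin d) ℂ)).dotProduct_mulVec_nonneg
    (w i)
  have hc : (0 : ℂ) ≤ ((Fintype.card G : ℂ))⁻¹ := by positivity
  exact (Complex.le_def.1 (mul_nonneg hc h)).1

lemma sum_prob
    (horth : ∀ i j, (∑ x, star (w i x) * w j x) = if i = j then 1 else 0)
    {ρ : Matrix (Fin d) (Fin d) ℂ} (hρtr : ρ.trace = 1) (g : G) :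
    ∑ i, prob R w ρ g i = (Fintype.card G : ℝ)⁻¹ := by
  unfold prob
  have hU : star (R g : Matrix (Fin d) (Fin d) ℂ) * (R g : Matrix (Fin d) (Fin d) ℂ) = 1 :=
    Matrix.mem_unitaryGroup_iff'.1 (R g).2
  rw [← Complex.re_sum, ← Finset.mul_sum, sum_sum_star_mul_mulVec_eq_trace horth,
    Matrix.trace_mul_cycle, hU, one_mul, hρtr, mul_one]
  rw [← Complex.ofReal_natCast, ← Complex.ofReal_inv, Complex.ofReal_re]

end Estimator

/-- In the NDCSE setting, let `W ⊆ End(V)` be conjugation-invariant,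
irreducible and block-preserving, with visibility coefficient `a = dim(W^H)/dim(W) > 0`.
Suppose `W` admits a Hilbert–Schmidt-orthogonal basis `{O_β}` of self-adjoint operators
all of the same operator norm, permuted up to scalars by conjugation by the
representation, each member being either diagonal or entirely off-diagonal in the
measurement basis.  Then for each `α`, the estimator with `Y = a⁻¹ O_α` satisfies
`Var[ô] ≤ ‖O_α‖_∞² / a` for every density matrix `ρ`. -/
theorem shadow_variance_tight_frame_bound
    (G : Type*) [Group G] [Fintype G] (d m : ℕ)
    (R : G →* Matrix.unitaryGroup (Fin d) ℂ)
    -- the orthogonal projections onto the summands V_1, ..., V_m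
    (P : Fin m → Matrix (Fin d) (Fin d) ℂ)
    (hPproj : ∀ k, P k * P k = P k)
    (hPsa : ∀ k, (P k)ᴴ = P k)
    (hPorth : ∀ k l, k ≠ l → P k * P l = 0)
    (hPsum : ∑ k, P k = 1)
    (hPinv : ∀ (g : G) k, (R g : Matrix (Fin d) (Fin d) ℂ) * P k
        = P k * (R g : Matrix (Fin d) (Fin d) ℂ))
    -- each summand is irreducible as a G-module
    (hirr : ∀ k (Q : Matrix (Fin d) (Fin d) ℂ), Q * Q = Q → Qᴴ = Q →
        Q * P k = Q → P k * Q = Q →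
        (∀ g : G, (R g : Matrix (Fin d) (Fin d) ℂ) * Q
          = Q * (R g : Matrix (Fin d) (Fin d) ℂ)) →
        Q = 0 ∨ Q = P k)
    -- an orthonormal basis adapted to the decomposition
    (w : Fin d → Fin d → ℂ)
    (horth : ∀ i j, (∑ x, star (w i x) * w j x) = if i = j then 1 else 0)
    (k : Fin d → Fin m)
    (hadapt : ∀ i, (P (k i)).mulVec (w i) = w i)
    -- an abelian subgroup H of G for which w is a non-degenerate simultaneous eigenbasis
    (H : Subgroup G)
    (hHab : ∀ a b : H, a * b = b * a)
    (χ : Fin d → H → ℂ)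
    (heig : ∀ (h : H) (i : Fin d),
      ((R (h : G) : Matrix (Fin d) (Fin d) ℂ)).mulVec (w i) = χ i h • w i)
    (hnd : ∀ i j, i ≠ j → k i = k j → χ i ≠ χ j)
    -- the operator subspace W: conjugation-invariant, irreducible, block-preserving
    (W : Submodule ℂ (Matrix (Fin d) (Fin d) ℂ))
    (hWinv : ∀ (g : G), ∀ X ∈ W, conjMap (R g : Matrix (Fin d) (Fin d) ℂ) X ∈ W)
    (hWirr : ∀ W' : Submodule ℂ (Matrix (Fin d) (Fin d) ℂ), W' ≤ W →
      (∀ (g : G), ∀ X ∈ W', conjMap (R g : Matrix (Fin d) (Fin d) ℂ) X ∈ W') →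
      W' = ⊥ ∨ W' = W)
    (hWdiag : ∀ X ∈ W, ∀ l, P l * X * P l = X * P l)
    -- the visibility coefficient a = dim W^H / dim W, positive
    (a : ℝ)
    (ha : a =
      (Module.finrank ℂ
        ↥(W ⊓ ⨅ h : H, LinearMap.ker
            (conjMap ((R (h : G) : Matrix (Fin d) (Fin d) ℂ)) - LinearMap.id)) : ℝ) /
      (Module.finrank ℂ ↥W : ℝ))
    (hapos : 0 < a)
    -- a Hilbert–Schmidt-orthogonal self-adjoint basis of W with uniform operator norm
    (B : Type*) [Fintype B]
    (Oβ : B → Matrix (Fin d) (Fin d) ℂ)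
    (hBmem : ∀ b, Oβ b ∈ W)
    (hBspan : Submodule.span ℂ (Set.range Oβ) = W)
    (hBli : LinearIndependent ℂ Oβ)
    (hBsa : ∀ b, (Oβ b)ᴴ = Oβ b)
    (hBorth : ∀ b b', b ≠ b' → ((Oβ b)ᴴ * Oβ b').trace = 0)
    (hBnorm : ∀ b b', opNorm (Oβ b) = opNorm (Oβ b'))
    -- (i) conjugation by the representation permutes the basis up to scalars
    (hBperm : ∀ (g : G) (b : B), ∃ (b' : B) (c : ℂ),
      conjMap (R g : Matrix (Fin d) (Fin d) ℂ) (Oβ b) = c • Oβ b')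
    -- (ii) each basis element is diagonal or entirely off-diagonal in the
    -- measurement basis
    (hBdiag : ∀ b,
      (∀ i j, i ≠ j → (∑ x, star (w i x) * ((Oβ b).mulVec (w j)) x) = 0) ∨
      (∀ i, (∑ x, star (w i x) * ((Oβ b).mulVec (w i)) x) = 0))
    -- a density matrix
    (ρ : Matrix (Fin d) (Fin d) ℂ)
    (hρ : ρ.PosSemidef) (hρtr : ρ.trace = 1) :
    ∀ α : B, variance R w ρ (((a : ℂ))⁻¹ • Oβ α) ≤ (opNorm (Oβ α)) ^ 2 / a := by
  classical
  intro α
  obtain ⟨_, hact⟩ := exists_mulAction_of_monomial (conjRep R) hBli hBperm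
  have := isPretransitive_of_irreducible_span (conjRep R) hBli hact
    (by rw [hBspan]; exact hWirr)
  set D : Finset B := Finset.univ.filter fun b =>
    ∀ i j, i ≠ j → (∑ x, star (w i x) * ((Oβ b).mulVec (w j)) x) = 0 with hD
  have hcardW : Module.finrank ℂ W = Fintype.card B := by
    rw [← hBspan, finrank_span_eq_card hBli]
  have hcardD : D.card ≤ Module.finrank ℂ
      ↥(W ⊓ ⨅ h : H, LinearMap.ker
        (conjMap ((R (h : G) : Matrix (Fin d) (Fin d) ℂ)) - LinearMap.id)) := by
    have hli : LinearIndependent ℂ fun b : D => Oβ b := hBli.comp _ Subtype.val_injective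
    rw [← Fintype.card_coe, ← finrank_span_eq_card hli]
    refine Submodule.finrank_mono (Submodule.span_le.2 ?_)
    rintro _ ⟨⟨b, hb⟩, rfl⟩
    refine ⟨hBmem b, ?_⟩
    simp only [SetLike.mem_coe, Submodule.mem_iInf, LinearMap.mem_ker, LinearMap.sub_apply,
      LinearMap.id_apply, sub_eq_zero]
    exact fun h => conjMap_eq_self_of_diagonal horth
      (Matrix.mem_unitaryGroup_iff.1 (R (h : G)).2) (heig h) (Finset.mem_filter.1 hb).2
  have hBpos : (0 : ℝ) < Fintype.card B := by
    exact_mod_cast Fintype.card_pos_iff.2 ⟨α⟩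
  have hGpos : (0 : ℝ) < Fintype.card G := by
    exact_mod_cast Fintype.card_pos
  have hDa : (D.card : ℝ) ≤ a * Fintype.card B := by
    rw [ha, hcardW, div_mul_cancel₀ _ hBpos.ne']
    exact_mod_cast hcardD
  have hfrac : (Fintype.card G : ℝ)⁻¹ * (Finset.univ.filter fun g : G => g • α ∈ D).card ≤ a := by
    have h : ((Finset.univ.filter fun g : G => g • α ∈ D).card : ℝ) * Fintype.card B
        = Fintype.card G * D.card := by
      exact_mod_cast card_filter_smul_mem_mul_card (G := G) D α
    rw [inv_mul_le_iff₀ hGpos]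
    refine le_of_mul_le_mul_right ?_ hBpos
    rw [h, mul_assoc]
    gcongr
  have hzero : ∀ g : G, g • α ∉ D → ∀ i, est R w (Oβ α) g i = 0 := by
    intro g hg i
    obtain ⟨c, -, hc⟩ := hact g α
    have hoff := (hBdiag (g • α)).resolve_left fun h => hg (by simpa [hD] using h)
    have hconj : (R g : Matrix (Fin d) (Fin d) ℂ) * Oβ α * star (R g : Matrix (Fin d) (Fin d) ℂ)
        = c • Oβ (g • α) := (conjMap_apply _ _).symm.trans hc
    have hsum : ∑ x, star (w i x) * ((c • Oβ (g • α)) *ᵥ w i) x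
        = c * ∑ x, star (w i x) * (Oβ (g • α) *ᵥ w i) x := by
      rw [Finset.mul_sum]
      refine Finset.sum_congr rfl fun x _ => ?_
      rw [Matrix.smul_mulVec, Pi.smul_apply, smul_eq_mul]
      ring
    rw [est, hconj, hsum, hoff, mul_zero, Complex.zero_re]
  have hpoint : ∀ g i, (est R w (((a : ℂ))⁻¹ • Oβ α) g i) ^ 2
      ≤ if g • α ∈ D then (a⁻¹ * opNorm (Oβ α)) ^ 2 else 0 := by
    intro g i
    rw [← Complex.ofReal_inv, est_ofReal_smul]
    split_ifs with hg
    · rw [mul_pow, mul_pow, ← sq_abs (est R w (Oβ α) g i)]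
      gcongr
      exact abs_est_le_opNorm R w horth _ _ _
    · rw [hzero g hg, mul_zero, zero_pow two_ne_zero]
  calc variance R w ρ (((a : ℂ))⁻¹ • Oβ α)
      ≤ ∑ g : G, ∑ i, prob R w ρ g i * (est R w (((a : ℂ))⁻¹ • Oβ α) g i) ^ 2 :=
        sub_le_self _ (sq_nonneg _)
    _ ≤ ∑ g : G, ∑ i, prob R w ρ g i *
          (if g • α ∈ D then (a⁻¹ * opNorm (Oβ α)) ^ 2 else 0) := by
        gcongr with g _ i _
        · exact prob_nonneg R w hρ g i
        · exact hpoint g i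
    _ = ((Fintype.card G : ℝ)⁻¹ * (Finset.univ.filter fun g : G => g • α ∈ D).card) *
          (a⁻¹ * opNorm (Oβ α)) ^ 2 := by
        simp_rw [← Finset.sum_mul, sum_prob R w horth hρtr]
        rw [← Finset.mul_sum, ← Finset.sum_filter, Finset.sum_const, nsmul_eq_mul, mul_assoc]
    _ ≤ a * (a⁻¹ * opNorm (Oβ α)) ^ 2 := by gcongr
    _ = (opNorm (Oβ α)) ^ 2 / a := by field_simp
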